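/- Let a be a base sequence and let r, s be nonnegative reals with digit sequences (r_n) and (s_n) with respect to a. Then: (i) if 0 ≤ r < 1/(a_1 a_2 ⋯ a_l), then r_i = 0 for all i ≤ l; (ii) if 0 ≤ s − r < 1/(a_1 a_2 ⋯ a_l) and (r_l ≠ a_l − 1 or s_l ≠ 0), then s_i = r_i for all i < l. -/

import Mathlib

open Set Filter
open scoped ENNReal

/-- `a₀ a₁ ⋯ a_{n-1}` as a real number: the product of the first `n` terms of the
base sequence (the paper's `a₁ ⋯ a_n`, re-indexed from 0). -/
noncomputable def bProd (a : ℕ → ℕ) (n : ℕ) : ℝ := ∏ k ∈ Finset.range n, (a k : ℝ)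

/-- The `n`-th digit (0-indexed; the paper's `(n+1)`-st digit) of the nonnegative
real `r` in base `a`:  `r_n = ⌊a₁⋯a_n (r - ⌊r⌋)⌋ - a_n ⌊a₁⋯a_{n-1} (r - ⌊r⌋)⌋`. -/
noncomputable def digit (a : ℕ → ℕ) (r : ℝ) (n : ℕ) : ℤ :=
  ⌊bProd a (n + 1) * Int.fract r⌋ - (a n : ℤ) * ⌊bProd a n * Int.fract r⌋

/-- `j_a(r) = { n : r_n ≠ r_{n+1} }`. -/
def jSet (a : ℕ → ℕ) (r : ℝ) : Set ℕ := {n | digit a r n ≠ digit a r (n + 1)}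

/-- An ideal of subsets of ℕ: closed under subsets and finite unions, containing
all singletons (hence nonempty). -/
def IsIdeal (I : Set (Set ℕ)) : Prop :=
  (∀ ⦃x y : Set ℕ⦄, x ∈ I → y ⊆ x → y ∈ I) ∧
  (∀ ⦃x y : Set ℕ⦄, x ∈ I → y ∈ I → x ∪ y ∈ I) ∧
  (∀ n : ℕ, ({n} : Set ℕ) ∈ I)

/-- Translation invariance of a family of subsets of ℕ. -/
def TransInv (I : Set (Set ℕ)) : Prop :=
  ∀ x ∈ I, ({n | ∃ m ∈ x, n = m + 1} ∈ I) ∧ ({n | n + 1 ∈ x} ∈ I)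

/-- A tall family: every infinite set of naturals has an infinite subset in the family. -/
def TallIdeal (I : Set (Set ℕ)) : Prop :=
  ∀ x : Set ℕ, x.Infinite → ∃ y, y ⊆ x ∧ y.Infinite ∧ y ∈ I

/-- The base sequence `a` is adapted to `I` if `{n : a_n ≠ a_{n+1}} ∈ I`. -/
def AdaptedTo (a : ℕ → ℕ) (I : Set (Set ℕ)) : Prop := {n | a n ≠ a (n + 1)} ∈ I

/-- A lower semicontinuous submeasure on subsets of ℕ. -/
def IsLscSubmeasure (φ : Set ℕ → ℝ≥0∞) : Prop :=
  φ ∅ = 0 ∧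
  (∀ ⦃x y : Set ℕ⦄, x ⊆ y → φ x ≤ φ y) ∧
  (∀ x y : Set ℕ, φ (x ∪ y) ≤ φ x + φ y) ∧
  (∀ n : ℕ, 0 < φ {n} ∧ φ {n} < ⊤) ∧
  (∀ x : Set ℕ, φ x = ⨆ n : ℕ, φ (x ∩ {k | k < n}))

/-- `Exh(φ) = { x ⊆ ℕ : φ(x \ {0,…,n-1}) → 0 }`. -/
def Exh (φ : Set ℕ → ℝ≥0∞) : Set (Set ℕ) :=
  {x | Filter.Tendsto (fun n => φ (x \ {k | k < n})) Filter.atTop (nhds 0)}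

/-- `pr(a)`: the set of primes dividing `a_n` for all but finitely many `n`. -/
def prSet (a : ℕ → ℕ) : Set ℕ := {p | p.Prime ∧ ∀ᶠ n in Filter.atTop, p ∣ a n}

/-- A base sequence is uniform if every prime dividing some `a_n` divides `a_n`
for all but finitely many `n`. -/
def UniformBase (a : ℕ → ℕ) : Prop :=
  ∀ p : ℕ, p.Prime → (∃ n, p ∣ a n) → ∀ᶠ n in Filter.atTop, p ∣ a n

/-- `ℚ_a`, viewed as a set of real numbers: fractions `k/l` with every prime
divisor of `l` in `pr(a)`. -/
def Qa (a : ℕ → ℕ) : Set ℝ :=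
  {r | ∃ (k : ℤ) (l : ℕ), 0 < l ∧ (∀ p : ℕ, p.Prime → p ∣ l → p ∈ prSet a) ∧
    r = (k : ℝ) / (l : ℝ)}

/-- `H = { r ∈ ℝ : j_a(|r|) ∈ I }`. -/
def Hset (a : ℕ → ℕ) (I : Set (Set ℕ)) : Set ℝ := {r | jSet a |r| ∈ I}

/-- `ρ(r,s) = φ(j_a(|r-s|)) + |r-s|`. -/
noncomputable def rho (a : ℕ → ℕ) (φ : Set ℕ → ℝ≥0∞) (r s : ℝ) : ℝ :=
  (φ (jSet a |r - s|)).toReal + |r - s|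

theorem bProd_succ (a : ℕ → ℕ) (n : ℕ) : bProd a (n + 1) = a n * bProd a n := by
  rw [bProd, bProd, Finset.prod_range_succ, mul_comm]

theorem bProd_pos {a : ℕ → ℕ} (ha : ∀ n, 2 ≤ a n) (n : ℕ) : 0 < bProd a n :=
  Finset.prod_pos fun k _ => by have := ha k; positivity

theorem floor_bProd_mul_fract (a : ℕ → ℕ) (r : ℝ) (n : ℕ) :
    ⌊bProd a n * Int.fract r⌋ =
      ⌊bProd a n * r⌋ - (∏ k ∈ Finset.range n, (a k : ℤ)) * ⌊r⌋ := by
  rw [← Int.floor_sub_intCast]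
  congr 1
  rw [Int.fract, bProd]
  push_cast
  ring

/-- Digits can be computed without first removing the integer part. -/
theorem digit_eq_floor_sub (a : ℕ → ℕ) (r : ℝ) (n : ℕ) :
    digit a r n = ⌊bProd a (n + 1) * r⌋ - (a n : ℤ) * ⌊bProd a n * r⌋ := by
  rw [digit, floor_bProd_mul_fract, floor_bProd_mul_fract, Finset.prod_range_succ]
  ring

theorem floor_bProd_mul_eq_ediv {a : ℕ → ℕ} (ha : ∀ n, 2 ≤ a n) (r : ℝ) (n : ℕ) :
    ⌊bProd a n * r⌋ = ⌊bProd a (n + 1) * r⌋ / (a n : ℤ) := by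
  have hpos : (0 : ℝ) < a n := by have := ha n; positivity
  rw [← Int.floor_div_natCast, bProd_succ, mul_assoc, mul_div_cancel_left₀ _ hpos.ne']

theorem digit_eq_emod {a : ℕ → ℕ} (ha : ∀ n, 2 ≤ a n) (r : ℝ) (n : ℕ) :
    digit a r n = ⌊bProd a (n + 1) * r⌋ % (a n : ℤ) := by
  rw [digit_eq_floor_sub, floor_bProd_mul_eq_ediv ha r n, Int.emod_def]

theorem floor_bProd_mul_eq_of_le {a : ℕ → ℕ} (ha : ∀ n, 2 ≤ a n) {r s : ℝ} {m n : ℕ}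
    (hmn : m ≤ n) (h : ⌊bProd a n * s⌋ = ⌊bProd a n * r⌋) :
    ⌊bProd a m * s⌋ = ⌊bProd a m * r⌋ := by
  induction n, hmn using Nat.le_induction with
  | base => exact h
  | succ n _ ih =>
    apply ih
    rw [floor_bProd_mul_eq_ediv ha s, floor_bProd_mul_eq_ediv ha r, h]

theorem digit_eq_of_floor_eq {a : ℕ → ℕ} (ha : ∀ n, 2 ≤ a n) {r s : ℝ} {l : ℕ}
    (h : ⌊bProd a l * s⌋ = ⌊bProd a l * r⌋) {i : ℕ} (hi : i < l) :
    digit a s i = digit a r i := by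
  rw [digit_eq_emod ha, digit_eq_emod ha, floor_bProd_mul_eq_of_le ha hi h]

/-- Adding one without a carry does not change the quotient. -/
theorem Int.succ_ediv_eq_of_no_carry {N b : ℤ} (hb : 0 < b)
    (h : N % b ≠ b - 1 ∨ (N + 1) % b ≠ 0) : (N + 1) / b = N / b := by
  have hN := Int.mul_ediv_add_emod N b
  have h0 := Int.emod_nonneg N hb.ne'
  have h1 := Int.emod_lt_of_pos N hb
  have hne : N % b ≠ b - 1 := by
    refine h.elim id fun h' heq => h' (Int.emod_eq_zero_of_dvd ⟨N / b + 1, ?_⟩)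
    linarith
  have hlt : N % b + 1 < b := by omega
  have hsplit : N + 1 = N % b + 1 + b * (N / b) := by linarith
  conv_lhs => rw [hsplit]
  rw [Int.add_mul_ediv_left _ _ hb.ne', Int.ediv_eq_zero_of_lt (by omega) hlt, zero_add]

/-- Lemma on digits; indices shifted from the paper's 1-based to 0-based,
so the paper's `a₁⋯a_l` is `bProd a l` and "for all i ≤ l" becomes "for all i < l". -/
theorem digits_basic (a : ℕ → ℕ) (ha : ∀ n, 2 ≤ a n) :
    (∀ r : ℝ, 0 ≤ r → ∀ l : ℕ, r < 1 / bProd a l → ∀ i < l, digit a r i = 0) ∧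
    (∀ r s : ℝ, 0 ≤ r → r ≤ s → ∀ l : ℕ, s - r < 1 / bProd a (l + 1) →
      (digit a r l ≠ (a l : ℤ) - 1 ∨ digit a s l ≠ 0) →
      ∀ i < l, digit a s i = digit a r i) := by
  refine ⟨fun r hr l hl i hi => ?_, fun r s _ hrs l hl hcarry i hi => ?_⟩
  · rw [lt_div_iff₀' (bProd_pos ha l)] at hl
    have h : ⌊bProd a l * r⌋ = ⌊bProd a l * (0 : ℝ)⌋ := by
      rw [mul_zero, Int.floor_zero, Int.floor_eq_zero_iff]
      exact ⟨mul_nonneg (bProd_pos ha l).le hr, hl⟩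
    rw [digit_eq_of_floor_eq ha h hi]
    simp [digit]
  · have hP := bProd_pos ha (l + 1)
    rw [lt_div_iff₀' hP, mul_sub] at hl
    have hle : ⌊bProd a (l + 1) * r⌋ ≤ ⌊bProd a (l + 1) * s⌋ :=
      Int.floor_mono (mul_le_mul_of_nonneg_left hrs hP.le)
    have hlt : ⌊bProd a (l + 1) * s⌋ ≤ ⌊bProd a (l + 1) * r⌋ + 1 := by
      rw [← Int.floor_add_one]
      exact Int.floor_mono (by linarith)
    refine digit_eq_of_floor_eq ha ?_ hi
    rw [floor_bProd_mul_eq_ediv ha s, floor_bProd_mul_eq_ediv ha r]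
    rw [digit_eq_emod ha, digit_eq_emod ha] at hcarry
    obtain heq | heq : ⌊bProd a (l + 1) * s⌋ = ⌊bProd a (l + 1) * r⌋ ∨
        ⌊bProd a (l + 1) * s⌋ = ⌊bProd a (l + 1) * r⌋ + 1 := by omega
    · rw [heq]
    · rw [heq] at hcarry ⊢
      exact Int.succ_ediv_eq_of_no_carry (by have := ha l; omega) hcarry
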